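/- Let A : ℝⁿ → ℝ be smooth and ℤⁿ-periodic, and let φ : ℝⁿ → ℝ be a smooth ℤⁿ-periodic function such that u(x) = ½|x|² + φ(x) has positive definite Hessian and satisfies Abreu's equation Σ_{i,j} ∂²u^{ij}/∂x_i∂x_j = A. Then there exist constants c₁, c₂ > 0 depending only on n and sup|A| such that c₁ < det(Hess u)(x) < c₂ for all x ∈ ℝⁿ. -/

import Mathlib

open MeasureTheory Matrix

/-- Partial derivative in the `i`-th coordinate direction. -/
noncomputable def pd {n : ℕ} (i : Fin n) (f : (Fin n → ℝ) → ℝ) (x : Fin n → ℝ) : ℝ :=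
  fderiv ℝ f x (Pi.single i 1)

/-- Hessian matrix `(u_{ij})` of `u` at `x`. -/
noncomputable def hess {n : ℕ} (u : (Fin n → ℝ) → ℝ) (x : Fin n → ℝ) :
    Matrix (Fin n) (Fin n) ℝ :=
  Matrix.of fun i j => pd i (pd j u) x

/-- `f : ℝⁿ → ℝ` is ℤⁿ-periodic. -/
def ZPer {n : ℕ} (f : (Fin n → ℝ) → ℝ) : Prop :=
  ∀ (x : Fin n → ℝ) (k : Fin n → ℤ), f (x + fun i => (k i : ℝ)) = f x

/-- Abreu's operator `∑_{i,j} ∂²u^{ij}/∂x_i∂x_j`, where `(u^{ij})` is the inverse Hessian. -/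
noncomputable def abreuOp {n : ℕ} (u : (Fin n → ℝ) → ℝ) (x : Fin n → ℝ) : ℝ :=
  ∑ i, ∑ j, pd i (pd j (fun z => (hess u z)⁻¹ i j)) x


open scoped ContDiff

section PartialDerivatives

variable {n : ℕ} {f g : (Fin n → ℝ) → ℝ}

theorem ContDiff.pd (hf : ContDiff ℝ ∞ f) (i : Fin n) : ContDiff ℝ ∞ (pd i f) := by
  have h : ContDiff ℝ ∞ (fderiv ℝ f) := hf.fderiv_right (by simp)
  exact h.clm_apply contDiff_const

theorem ContDiff.differentiableAt_of_smooth (hf : ContDiff ℝ ∞ f) (x : Fin n → ℝ) :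
    DifferentiableAt ℝ f x :=
  hf.differentiable (by simp) x

theorem pd_comm (hf : ContDiff ℝ ∞ f) (i j : Fin n) (x : Fin n → ℝ) :
    pd i (pd j f) x = pd j (pd i f) x := by
  have h : ContDiff ℝ ∞ (fderiv ℝ f) := hf.fderiv_right (by simp)
  have hd : DifferentiableAt ℝ (fderiv ℝ f) x := h.differentiable (by simp) x
  have key : ∀ a b : Fin n,
      pd a (pd b f) x = fderiv ℝ (fderiv ℝ f) x (Pi.single a 1) (Pi.single b 1) := by
    intro a b
    change fderiv ℝ (fun y => fderiv ℝ f y (Pi.single b 1)) x _ = _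
    rw [fderiv_clm_apply hd (differentiableAt_const _)]
    simp
  rw [key, key]
  exact hf.contDiffAt.isSymmSndFDerivAt
    (by simpa using WithTop.coe_le_coe.2 (le_top : (2 : ℕ∞) ≤ ⊤)) _ _

theorem pd_add (i : Fin n) {x : Fin n → ℝ} (hf : DifferentiableAt ℝ f x)
    (hg : DifferentiableAt ℝ g x) : pd i (fun y => f y + g y) x = pd i f x + pd i g x := by
  simp [pd, fderiv_fun_add hf hg]

theorem pd_sub (i : Fin n) {x : Fin n → ℝ} (hf : DifferentiableAt ℝ f x)
    (hg : DifferentiableAt ℝ g x) : pd i (fun y => f y - g y) x = pd i f x - pd i g x := by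
  simp [pd, fderiv_fun_sub hf hg]

theorem pd_mul (i : Fin n) {x : Fin n → ℝ} (hf : DifferentiableAt ℝ f x)
    (hg : DifferentiableAt ℝ g x) :
    pd i (fun y => f y * g y) x = pd i f x * g x + f x * pd i g x := by
  simp [pd, fderiv_fun_mul hf hg]
  ring

theorem pd_const_mul (i : Fin n) (c : ℝ) {x : Fin n → ℝ} (hf : DifferentiableAt ℝ f x) :
    pd i (fun y => c * f y) x = c * pd i f x := by
  simp [pd, fderiv_const_mul hf]

theorem pd_sum (i : Fin n) {ι : Type*} (s : Finset ι) {F : ι → (Fin n → ℝ) → ℝ} {x : Fin n → ℝ}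
    (hF : ∀ k ∈ s, DifferentiableAt ℝ (F k) x) :
    pd i (fun y => ∑ k ∈ s, F k y) x = ∑ k ∈ s, pd i (F k) x := by
  simp [pd, fderiv_fun_sum hF]

theorem pd_const (i : Fin n) (c : ℝ) (x : Fin n → ℝ) : pd i (fun _ => c) x = 0 := by
  simp [pd]

theorem pd_proj (i j : Fin n) (x : Fin n → ℝ) :
    pd i (fun y => y j) x = (1 : Matrix (Fin n) (Fin n) ℝ) i j := by
  simp [pd, (hasFDerivAt_apply (𝕜 := ℝ) j x).fderiv, Matrix.one_apply, Pi.single_apply, eq_comm]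

theorem ZPer.pd (hf : ZPer f) (i : Fin n) : ZPer (pd i f) := by
  intro x k
  have h : (fun y => f (y + fun i => (k i : ℝ))) = f := funext fun y => hf y k
  unfold _root_.pd
  rw [← fderiv_comp_add_right, h]

theorem ZPer.exists_mem_Icc (x : Fin n → ℝ) :
    ∃ y ∈ Set.Icc (0 : Fin n → ℝ) 1, ∀ f : (Fin n → ℝ) → ℝ, ZPer f → f y = f x := by
  refine ⟨fun i => Int.fract (x i), ⟨fun i => Int.fract_nonneg _, fun i => (Int.fract_lt_one _).le⟩,
    fun f hf => ?_⟩
  rw [← hf _ fun i => ⌊x i⌋]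
  congr 1
  ext i
  exact Int.fract_add_floor _

theorem ZPer.exists_forall_ge (hf : ZPer f) (hc : Continuous f) : ∃ x, ∀ y, f x ≤ f y := by
  obtain ⟨x, -, hx⟩ := (isCompact_Icc (a := (0 : Fin n → ℝ)) (b := 1)).exists_isMinOn
    ⟨0, by simp [Set.mem_Icc]⟩ hc.continuousOn
  refine ⟨x, fun y => ?_⟩
  obtain ⟨z, hz, hzy⟩ := ZPer.exists_mem_Icc y
  rw [← hzy f hf]
  exact hx hz

theorem hasDerivAt_line (hf : ContDiff ℝ ∞ f) (x v : Fin n → ℝ) (t : ℝ) :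
    HasDerivAt (fun s : ℝ => f (x + s • v)) (∑ i, v i * pd i f (x + t • v)) t := by
  have h1 : HasDerivAt (fun s : ℝ => x + s • v) v t := by
    simpa using ((hasDerivAt_id t).smul_const v).const_add x
  have h2 := (hf.differentiableAt_of_smooth (x + t • v)).hasFDerivAt.comp_hasDerivAt t h1
  refine h2.congr_deriv ?_
  have h3 : ∀ l : (Fin n → ℝ) →L[ℝ] ℝ, l v = ∑ i, v i * l (Pi.single i 1) := by
    intro l
    conv_lhs => rw [← Finset.univ_sum_single v]
    rw [map_sum]
    refine Finset.sum_congr rfl fun i _ => ?_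
    rw [← smul_eq_mul, ← map_smul, ← Pi.single_smul, smul_eq_mul, mul_one]
  exact h3 _

theorem pd_eq_zero_of_forall_ge {x : Fin n → ℝ} (hx : ∀ y, f x ≤ f y) (i : Fin n) :
    pd i f x = 0 := by
  have h : IsLocalMin f x := Filter.Eventually.of_forall hx
  simp [pd, h.fderiv_eq_zero]

theorem deriv_deriv_nonneg_of_forall_ge {p : ℝ → ℝ} {a : ℝ} (hp : ContinuousAt p a)
    (ha : ∀ t, p a ≤ p t) : 0 ≤ deriv (deriv p) a := by
  by_contra! h
  have hmin : IsLocalMin p a := Filter.Eventually.of_forall ha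
  have hmax := isLocalMax_of_deriv_deriv_neg h hmin.deriv_eq_zero hp
  have hconst : p =ᶠ[nhds a] fun _ => p a := by
    filter_upwards [hmax] with t ht using le_antisymm ht (ha t)
  have h2 := hconst.deriv.deriv_eq
  simp at h2
  linarith

theorem posSemidef_hess_of_forall_ge (hf : ContDiff ℝ ∞ f) {x : Fin n → ℝ}
    (hx : ∀ y, f x ≤ f y) : (hess f x).PosSemidef := by
  refine Matrix.PosSemidef.of_dotProduct_mulVec_nonneg ?_ fun v => ?_
  · ext i j
    simp [hess, pd_comm hf i j]
  have h1 : deriv (fun s : ℝ => f (x + s • v)) = fun t => ∑ i, v i * pd i f (x + t • v) :=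
    funext fun t => (hasDerivAt_line hf x v t).deriv
  have h2 : HasDerivAt (fun t : ℝ => ∑ i, v i * pd i f (x + t • v))
      (∑ i, v i * ∑ j, v j * pd j (pd i f) (x + (0 : ℝ) • v)) 0 :=
    HasDerivAt.fun_sum fun i _ => (hasDerivAt_line (hf.pd i) x v 0).const_mul (v i)
  have h3 := deriv_deriv_nonneg_of_forall_ge (p := fun s : ℝ => f (x + s • v)) (a := 0)
    (hasDerivAt_line hf x v 0).continuousAt (by simpa using fun t => hx _)
  rw [h1, h2.deriv] at h3
  refine h3.trans_eq ?_
  simp only [dotProduct, Matrix.mulVec, hess, Matrix.of_apply, Pi.star_apply, star_trivial,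
    zero_smul, add_zero]
  refine Finset.sum_congr rfl fun i _ => ?_
  congr 1
  refine Finset.sum_congr rfl fun j _ => ?_
  rw [pd_comm hf i j, mul_comm]

end PartialDerivatives

section MatrixInequalities

variable {n : ℕ} {M K : Matrix (Fin n) (Fin n) ℝ}

theorem Matrix.PosSemidef.trace_mul_nonneg (hM : M.PosSemidef) (hK : K.PosSemidef) :
    0 ≤ (M * K).trace := by
  open scoped MatrixOrder in
  obtain ⟨B, rfl⟩ := CStarAlgebra.nonneg_iff_eq_star_mul_self.mp hM.nonneg
  rw [Matrix.mul_assoc, Matrix.trace_mul_comm, Matrix.star_eq_conjTranspose]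
  exact (hK.mul_mul_conjTranspose_same B).trace_nonneg

theorem Matrix.posSemidef_dotProduct_smul_one_sub_vecMulVec (v : Fin n → ℝ) :
    ((v ⬝ᵥ v) • (1 : Matrix (Fin n) (Fin n) ℝ) - vecMulVec v v).PosSemidef := by
  refine .of_dotProduct_mulVec_nonneg ?_ fun w => ?_
  · ext i j
    simp [vecMulVec_apply, Matrix.one_apply, eq_comm, mul_comm]
  · have h := Finset.sum_mul_sq_le_sq_mul_sq Finset.univ v w
    have : star w ⬝ᵥ ((v ⬝ᵥ v) • (1 : Matrix (Fin n) (Fin n) ℝ) - vecMulVec v v) *ᵥ w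
        = (∑ i, v i ^ 2) * (∑ i, w i ^ 2) - (∑ i, v i * w i) ^ 2 := by
      simp only [star_trivial, sub_mulVec, dotProduct_sub, smul_mulVec, one_mulVec,
        dotProduct_smul, vecMulVec_mulVec, smul_eq_mul, op_smul_eq_smul]
      rw [dotProduct_comm w v]
      simp only [dotProduct, pow_two]
    rw [this]
    linarith

theorem Matrix.PosSemidef.dotProduct_mulVec_le (hM : M.PosSemidef) (v : Fin n → ℝ) :
    v ⬝ᵥ M *ᵥ v ≤ M.trace * (v ⬝ᵥ v) := by
  have h := hM.trace_mul_nonneg (posSemidef_dotProduct_smul_one_sub_vecMulVec v)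
  rw [Matrix.mul_sub, trace_sub, mul_vecMulVec, trace_vecMulVec, Matrix.mul_smul, Matrix.mul_one,
    trace_smul, smul_eq_mul, mul_comm,
    dotProduct_comm (M *ᵥ v)] at h
  linarith

theorem Matrix.PosSemidef.det_le_trace_pow (hM : M.PosSemidef) : M.det ≤ M.trace ^ n := by
  have h0 := hM.eigenvalues_nonneg
  rw [hM.isHermitian.det_eq_prod_eigenvalues, hM.isHermitian.trace_eq_sum_eigenvalues]
  simp only [RCLike.ofReal_real_eq_id, id_eq]
  calc ∏ i, hM.isHermitian.eigenvalues i
      ≤ ∏ _i : Fin n, ∑ j, hM.isHermitian.eigenvalues j :=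
        Finset.prod_le_prod (fun i _ => h0 i) fun i _ =>
          Finset.single_le_sum (fun j _ => h0 j) (Finset.mem_univ i)
    _ = _ := by simp

end MatrixInequalities

section MatrixDerivatives

variable {n : ℕ} {H : (Fin n → ℝ) → Matrix (Fin n) (Fin n) ℝ}

theorem ContDiff.matrix_det (hH : ∀ i j, ContDiff ℝ ∞ fun x => H x i j) :
    ContDiff ℝ ∞ fun x => (H x).det := by
  simp only [Matrix.det_apply]
  exact ContDiff.sum fun σ _ => (contDiff_prod fun i _ => hH _ _).const_smul _

theorem ContDiff.matrix_inv_apply (hH : ∀ i j, ContDiff ℝ ∞ fun x => H x i j)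
    (h0 : ∀ x, (H x).det ≠ 0) (i j : Fin n) : ContDiff ℝ ∞ fun x => (H x)⁻¹ i j := by
  simp only [Matrix.inv_def, Ring.inverse_eq_inv', Matrix.smul_apply, smul_eq_mul,
    Matrix.adjugate_apply]
  refine ((ContDiff.matrix_det hH).inv h0).mul (ContDiff.matrix_det fun a b => ?_)
  simp only [Matrix.updateRow_apply]
  split_ifs
  · exact contDiff_const
  · exact hH a b

theorem Matrix.hasDerivAt_det_line {M : Matrix (Fin n) (Fin n) ℝ} (hM : M.det ≠ 0)
    (N : Matrix (Fin n) (Fin n) ℝ) :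
    HasDerivAt (fun t : ℝ => (M + t • N).det) (M.det * (M⁻¹ * N).trace) 0 := by
  have hu : IsUnit M.det := hM.isUnit
  have h1 : ∀ t : ℝ, (M + t • N).det = M.det * (1 + t • (M⁻¹ * N)).det := by
    intro t
    rw [← Matrix.det_mul, Matrix.mul_add, Matrix.mul_one, Matrix.mul_smul, ← Matrix.mul_assoc,
      Matrix.mul_nonsing_inv _ hu, Matrix.one_mul]
  simp only [h1]
  refine HasDerivAt.const_mul _ ?_
  simp_rw [fun t : ℝ => Matrix.det_one_add_smul t (M⁻¹ * N)]
  set P := (det (1 + (Polynomial.X : Polynomial ℝ) • (M⁻¹ * N).map Polynomial.C)).divX.divX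
  have h2 := (((hasDerivAt_id (0 : ℝ)).const_mul (M⁻¹ * N).trace).const_add 1).add
    ((P.hasDerivAt 0).mul ((hasDerivAt_id (0 : ℝ)).pow 2))
  exact h2.congr_deriv (by simp)

theorem pd_det (hH : ∀ i j, ContDiff ℝ ∞ fun x => H x i j) {x : Fin n → ℝ}
    (h0 : (H x).det ≠ 0) (k : Fin n) :
    pd k (fun y => (H y).det) x =
      (H x).det * ∑ a, ∑ b, (H x)⁻¹ a b * pd k (fun y => H y b a) x := by
  let T : (Fin n → Fin n → ℝ) → ℝ := fun N => ∑ σ : Equiv.Perm (Fin n),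
    Equiv.Perm.sign σ • ∏ i, N (σ i) i
  have hTdet : ∀ N : Fin n → Fin n → ℝ, T N = (Matrix.of N).det :=
    fun N => (Matrix.det_apply _).symm
  let h : (Fin n → ℝ) → Fin n → Fin n → ℝ := fun y i j => H y i j
  have hT : DifferentiableAt ℝ T (h x) := by
    refine DifferentiableAt.fun_sum fun σ _ => DifferentiableAt.const_smul ?_ _
    fun_prop
  let N : Fin n → Fin n → ℝ := fun i j => pd k (fun y => H y i j) x
  have hd : HasFDerivAt h (ContinuousLinearMap.pi fun i => ContinuousLinearMap.pi fun j =>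
      fderiv ℝ (fun y => H y i j) x) x := by
    rw [hasFDerivAt_pi]
    intro i
    rw [hasFDerivAt_pi]
    exact fun j => ((hH i j).differentiableAt_of_smooth x).hasFDerivAt
  have hc := hT.hasFDerivAt.comp x hd
  have hl : HasDerivAt (fun t : ℝ => h x + t • N) N 0 := by
    simpa using ((hasDerivAt_id (0 : ℝ)).smul_const N).const_add (h x)
  have hl2 := HasFDerivAt.comp_hasDerivAt (0 : ℝ) (l := T) (l' := fderiv ℝ T (h x))
    (by simpa using hT.hasFDerivAt) hl
  have hl3 : HasDerivAt (T ∘ fun t : ℝ => h x + t • N)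
      ((H x).det * ((H x)⁻¹ * Matrix.of N).trace) 0 := by
    convert Matrix.hasDerivAt_det_line h0 (Matrix.of N) using 1
    ext t
    exact hTdet _
  have hcomp : (fun y => (H y).det) = T ∘ h := funext fun y => (hTdet _).symm
  rw [hcomp, pd, hc.fderiv]
  exact hl2.unique hl3

theorem pd_inv_apply (hH : ∀ i j, ContDiff ℝ ∞ fun x => H x i j)
    (h0 : ∀ x, (H x).det ≠ 0) (x : Fin n → ℝ) (k i j : Fin n) :
    pd k (fun y => (H y)⁻¹ i j) x =
      -∑ a, ∑ b, (H x)⁻¹ i a * pd k (fun y => H y a b) x * (H x)⁻¹ b j := by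
  have hG := ContDiff.matrix_inv_apply hH h0
  let dH : Matrix (Fin n) (Fin n) ℝ := Matrix.of fun a b => pd k (fun y => H y a b) x
  let dG : Matrix (Fin n) (Fin n) ℝ := Matrix.of fun a b => pd k (fun y => (H y)⁻¹ a b) x
  have h1 : dG * H x + (H x)⁻¹ * dH = 0 := by
    ext a c
    have h2 : (fun y => ∑ b, (H y)⁻¹ a b * H y b c) =
        fun _ => (1 : Matrix (Fin n) (Fin n) ℝ) a c := by
      ext y
      rw [← Matrix.mul_apply, Matrix.nonsing_inv_mul _ (h0 y).isUnit]
    have h3 := pd_const k ((1 : Matrix (Fin n) (Fin n) ℝ) a c) x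
    rw [← h2, pd_sum k _ fun b _ => ((hG a b).mul (hH b c)).differentiableAt_of_smooth x] at h3
    rw [Matrix.zero_apply, ← h3, Matrix.add_apply, Matrix.mul_apply, Matrix.mul_apply,
      ← Finset.sum_add_distrib]
    exact Finset.sum_congr rfl fun b _ => (pd_mul k ((hG a b).differentiableAt_of_smooth x)
      ((hH b c).differentiableAt_of_smooth x)).symm
  have h4 : dG = -((H x)⁻¹ * dH * (H x)⁻¹) := by
    have h5 : (dG * H x + (H x)⁻¹ * dH) * (H x)⁻¹ = 0 := by rw [h1, Matrix.zero_mul]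
    rw [Matrix.add_mul, Matrix.mul_assoc dG, Matrix.mul_nonsing_inv _ (h0 x).isUnit,
      Matrix.mul_one] at h5
    exact eq_neg_of_add_eq_zero_left h5
  have h6 := congrFun (congrFun h4 i) j
  rw [Matrix.neg_apply, Matrix.mul_apply] at h6
  simp only [Matrix.mul_apply, Finset.sum_mul] at h6
  rw [Finset.sum_comm] at h6
  exact h6

end MatrixDerivatives

section AbreuOperator

variable {n : ℕ} {u : (Fin n → ℝ) → ℝ}

theorem contDiff_hess (hu : ContDiff ℝ ∞ u) (i j : Fin n) :
    ContDiff ℝ ∞ fun x => hess u x i j :=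
  (hu.pd j).pd i

theorem contDiff_inv_hess (hu : ContDiff ℝ ∞ u) (hpos : ∀ x, (hess u x).PosDef) (i j : Fin n) :
    ContDiff ℝ ∞ fun x => (hess u x)⁻¹ i j :=
  ContDiff.matrix_inv_apply (contDiff_hess hu) (fun x => (hpos x).det_pos.ne') i j

theorem inv_hess_symm (hpos : ∀ x, (hess u x).PosDef) (x : Fin n → ℝ) (i j : Fin n) :
    (hess u x)⁻¹ i j = (hess u x)⁻¹ j i := by
  simpa using ((hpos x).inv.isHermitian.apply i j).symm

/-- The negative logarithm of the Hessian determinant. -/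
noncomputable def negLogDet (u : (Fin n → ℝ) → ℝ) (x : Fin n → ℝ) : ℝ :=
  -Real.log (hess u x).det

theorem exp_negLogDet (hpos : ∀ x, (hess u x).PosDef) (x : Fin n → ℝ) :
    Real.exp (negLogDet u x) = (hess u x).det⁻¹ := by
  rw [negLogDet, Real.exp_neg, Real.exp_log (hpos x).det_pos]

theorem contDiff_negLogDet (hu : ContDiff ℝ ∞ u) (hpos : ∀ x, (hess u x).PosDef) :
    ContDiff ℝ ∞ (negLogDet u) :=
  ((ContDiff.matrix_det (contDiff_hess hu)).log fun x => (hpos x).det_pos.ne').neg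

theorem pd_negLogDet (hu : ContDiff ℝ ∞ u) (hpos : ∀ x, (hess u x).PosDef) (k : Fin n)
    (x : Fin n → ℝ) :
    pd k (negLogDet u) x =
      -∑ a, ∑ b, (hess u x)⁻¹ a b * pd k (fun y => hess u y b a) x := by
  have h0 := (hpos x).det_pos.ne'
  have hd := (ContDiff.matrix_det (contDiff_hess hu)).differentiableAt_of_smooth x
  have h1 : pd k (negLogDet u) x = -((hess u x).det⁻¹ * pd k (fun y => (hess u y).det) x) := by
    change fderiv ℝ (fun y => -Real.log (hess u y).det) x _ = _
    rw [(hd.hasFDerivAt.log h0).fun_neg.fderiv]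
    simp [pd]
  rw [h1, pd_det (contDiff_hess hu) h0, inv_mul_cancel_left₀ h0]

theorem sum_pd_inv_hess (hu : ContDiff ℝ ∞ u) (hpos : ∀ x, (hess u x).PosDef) (i : Fin n)
    (x : Fin n → ℝ) :
    ∑ j, pd j (fun y => (hess u y)⁻¹ i j) x =
      ∑ a, (hess u x)⁻¹ i a * pd a (negLogDet u) x := by
  simp only [pd_inv_apply (contDiff_hess hu) (fun x => (hpos x).det_pos.ne'),
    pd_negLogDet hu hpos, mul_neg, Finset.sum_neg_distrib, Finset.mul_sum]
  rw [neg_inj, Finset.sum_comm]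
  refine Finset.sum_congr rfl fun a _ => ?_
  rw [Finset.sum_comm]
  refine Finset.sum_congr rfl fun b _ => Finset.sum_congr rfl fun j _ => ?_
  have h : pd j (fun y => hess u y a b) x = pd a (fun y => hess u y j b) x :=
    pd_comm (hu.pd b) j a x
  rw [h]
  ring

/-- The operator `F ↦ ∑_{i,k} ∂_i (u^{ik} ∂_k F)`. -/
noncomputable def hessDiv (u F : (Fin n → ℝ) → ℝ) (x : Fin n → ℝ) : ℝ :=
  ∑ i, pd i (fun y => ∑ k, (hess u y)⁻¹ i k * pd k F y) x

theorem abreuOp_eq_hessDiv (hu : ContDiff ℝ ∞ u) (hpos : ∀ x, (hess u x).PosDef)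
    (x : Fin n → ℝ) : abreuOp u x = hessDiv u (negLogDet u) x := by
  refine Finset.sum_congr rfl fun i _ => ?_
  rw [← pd_sum i _ fun j _ =>
    ((contDiff_inv_hess hu hpos i j).pd j).differentiableAt_of_smooth x]
  simp only [sum_pd_inv_hess hu hpos]

section

variable {F K : (Fin n → ℝ) → ℝ}

theorem contDiff_sum_inv_hess_mul_pd (hu : ContDiff ℝ ∞ u) (hpos : ∀ x, (hess u x).PosDef)
    (hF : ContDiff ℝ ∞ F) (i : Fin n) :
    ContDiff ℝ ∞ fun y => ∑ k, (hess u y)⁻¹ i k * pd k F y :=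
  ContDiff.sum fun k _ => (contDiff_inv_hess hu hpos i k).mul (hF.pd k)

theorem hessDiv_sub (hu : ContDiff ℝ ∞ u) (hpos : ∀ x, (hess u x).PosDef)
    (hF : ContDiff ℝ ∞ F) (hK : ContDiff ℝ ∞ K) (x : Fin n → ℝ) :
    hessDiv u (fun y => F y - K y) x = hessDiv u F x - hessDiv u K x := by
  simp only [hessDiv, ← Finset.sum_sub_distrib]
  refine Finset.sum_congr rfl fun i _ => ?_
  rw [← pd_sub i ((contDiff_sum_inv_hess_mul_pd hu hpos hF i).differentiableAt_of_smooth x)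
    ((contDiff_sum_inv_hess_mul_pd hu hpos hK i).differentiableAt_of_smooth x)]
  simp only [← Finset.sum_sub_distrib, ← mul_sub,
    pd_sub _ (hF.differentiableAt_of_smooth _) (hK.differentiableAt_of_smooth _)]

theorem hessDiv_const_mul (hu : ContDiff ℝ ∞ u) (hpos : ∀ x, (hess u x).PosDef)
    (hF : ContDiff ℝ ∞ F) (c : ℝ) (x : Fin n → ℝ) :
    hessDiv u (fun y => c * F y) x = c * hessDiv u F x := by
  simp only [hessDiv, Finset.mul_sum]
  refine Finset.sum_congr rfl fun i _ => ?_
  rw [← pd_const_mul i c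
    ((contDiff_sum_inv_hess_mul_pd hu hpos hF i).differentiableAt_of_smooth x)]
  simp only [Finset.mul_sum, pd_const_mul _ c (hF.differentiableAt_of_smooth _), mul_left_comm]

theorem hessDiv_eq (hu : ContDiff ℝ ∞ u) (hpos : ∀ x, (hess u x).PosDef)
    (hF : ContDiff ℝ ∞ F) (x : Fin n → ℝ) :
    hessDiv u F x = ((hess u x)⁻¹ * hess F x).trace +
      ∑ k, (∑ a, (hess u x)⁻¹ k a * pd a (negLogDet u) x) * pd k F x := by
  simp only [← sum_pd_inv_hess hu hpos, Finset.sum_mul, hessDiv, Matrix.trace, Matrix.diag_apply,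
    Matrix.mul_apply]
  rw [Finset.sum_comm (f := fun k j => pd j (fun y => (hess u y)⁻¹ k j) x * pd k F x),
    ← Finset.sum_add_distrib]
  refine Finset.sum_congr rfl fun i _ => ?_
  rw [pd_sum i _ fun k _ =>
    ((contDiff_inv_hess hu hpos i k).mul (hF.pd k)).differentiableAt_of_smooth x,
    ← Finset.sum_add_distrib]
  refine Finset.sum_congr rfl fun k _ => ?_
  rw [pd_mul i ((contDiff_inv_hess hu hpos i k).differentiableAt_of_smooth x)
    ((hF.pd k).differentiableAt_of_smooth x), pd_comm hF i k x, add_comm]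
  simp only [inv_hess_symm hpos _ i k]
  rfl

theorem hessDiv_nonneg_of_forall_ge (hu : ContDiff ℝ ∞ u) (hpos : ∀ x, (hess u x).PosDef)
    (hF : ContDiff ℝ ∞ F) {x : Fin n → ℝ} (hx : ∀ y, F x ≤ F y) : 0 ≤ hessDiv u F x := by
  rw [hessDiv_eq hu hpos hF]
  simp only [pd_eq_zero_of_forall_ge hx, mul_zero, Finset.sum_const_zero, add_zero]
  exact (hpos x).inv.posSemidef.trace_mul_nonneg (posSemidef_hess_of_forall_ge hF hx)

end

end AbreuOperator

section PeriodicPotential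

variable {n : ℕ} {φ : (Fin n → ℝ) → ℝ}

/-- The function `½|x|² + φ(x)`. -/
noncomputable def quadAdd (φ : (Fin n → ℝ) → ℝ) (y : Fin n → ℝ) : ℝ :=
  (1 / 2 : ℝ) * ∑ i, y i ^ 2 + φ y

theorem contDiff_quadAdd (hφ : ContDiff ℝ ∞ φ) : ContDiff ℝ ∞ (quadAdd φ) := by
  unfold quadAdd
  fun_prop

theorem pd_quadAdd (hφ : ContDiff ℝ ∞ φ) (j : Fin n) (x : Fin n → ℝ) :
    pd j (quadAdd φ) x = x j + pd j φ x := by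
  unfold quadAdd
  have h1 : ∀ i : Fin n, ContDiff ℝ ∞ fun y : Fin n → ℝ => y i := fun i => by fun_prop
  have h2 : ∀ i : Fin n, ContDiff ℝ ∞ fun y : Fin n → ℝ => y i ^ 2 := fun i => (h1 i).pow 2
  have h3 : ContDiff ℝ ∞ fun y : Fin n → ℝ => ∑ i, y i ^ 2 := ContDiff.sum fun i _ => h2 i
  rw [pd_add j ((contDiff_const.mul h3).differentiableAt_of_smooth x)
    (hφ.differentiableAt_of_smooth x), pd_const_mul j _ (h3.differentiableAt_of_smooth x),
    pd_sum j _ fun i _ => (h2 i).differentiableAt_of_smooth x]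
  simp only [pow_two, pd_mul j ((h1 _).differentiableAt_of_smooth x)
    ((h1 _).differentiableAt_of_smooth x), pd_proj, Matrix.one_apply, ite_mul,
    mul_ite, one_mul, mul_one, zero_mul, mul_zero, Finset.sum_add_distrib, Finset.sum_ite_eq,
    Finset.mem_univ, if_true]
  ring

theorem hess_quadAdd (hφ : ContDiff ℝ ∞ φ) (x : Fin n → ℝ) :
    hess (quadAdd φ) x = 1 + hess φ x := by
  ext i j
  simp only [hess, Matrix.of_apply, Matrix.add_apply]
  rw [funext (pd_quadAdd hφ j), pd_add i
    ((by fun_prop : ContDiff ℝ ∞ fun y : Fin n → ℝ => y j).differentiableAt_of_smooth x)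
    ((hφ.pd j).differentiableAt_of_smooth x), pd_proj]

theorem zper_negLogDet_quadAdd (hφ : ContDiff ℝ ∞ φ) (hper : ZPer φ) :
    ZPer (negLogDet (quadAdd φ)) := by
  intro x k
  simp only [negLogDet, hess_quadAdd hφ]
  congr 4
  ext i j
  exact (hper.pd j).pd i x k

theorem hasDerivAt_coordinate_line {f : (Fin n → ℝ) → ℝ} (hf : ContDiff ℝ ∞ f)
    (x : Fin n → ℝ) (i : Fin n) (t : ℝ) :
    HasDerivAt (fun s : ℝ => f (x + s • Pi.single i 1)) (pd i f (x + t • Pi.single i 1)) t :=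
  (hasDerivAt_line hf x (Pi.single i 1) t).congr_deriv (by simp [Pi.single_apply])

theorem abs_pd_le_one (hφ : ContDiff ℝ ∞ φ) (hper : ZPer φ)
    (hpos : ∀ x, (hess (quadAdd φ) x).PosDef) (i : Fin n) (x : Fin n → ℝ) :
    |pd i φ x| ≤ 1 := by
  set q : ℝ → ℝ := fun s => φ (x + s • Pi.single i 1)
  set q' : ℝ → ℝ := fun s => pd i φ (x + s • Pi.single i 1)
  have hq : ∀ t, HasDerivAt q (q' t) t := hasDerivAt_coordinate_line hφ x i
  have hq' : ∀ t, HasDerivAt (fun s => s + q' s)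
      (1 + pd i (pd i φ) (x + t • Pi.single i 1)) t :=
    fun t => (hasDerivAt_id t).add (hasDerivAt_coordinate_line (hφ.pd i) x i t)
  have hmono : Monotone fun s => s + q' s := by
    refine monotone_of_hasDerivAt_nonneg hq' fun t => ?_
    have h := (hpos (x + t • Pi.single i 1)).posSemidef.diag_nonneg (i := i)
    rw [hess_quadAdd hφ] at h
    simpa [hess] using h
  have hshift : ∀ m : ℤ, q m = q 0 := by
    intro m
    simp only [q, zero_smul, add_zero]
    rw [← hper x (Pi.single i m)]
    congr 2
    ext j
    by_cases h : j = i
    · subst h; simp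
    · simp [h]
  have hcont : Continuous q := continuous_iff_continuousAt.2 fun t => (hq t).continuousAt
  obtain ⟨a, ha, ha0⟩ := exists_hasDerivAt_eq_zero (f := q) (f' := q') (zero_lt_one' ℝ)
    hcont.continuousOn (by simpa using (hshift 1).symm) fun t _ => hq t
  obtain ⟨b, hb, hb0⟩ := exists_hasDerivAt_eq_zero (f := q) (f' := q')
    (by norm_num : (-1 : ℝ) < 0)
    hcont.continuousOn (by simpa using hshift (-1)) fun t _ => hq t
  have h1 := hmono ha.1.le
  have h2 := hmono hb.2.le
  have h3 : q' 0 = pd i φ x := by simp [q']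
  simp only [ha0, hb0, h3] at h1 h2
  rw [abs_le]
  constructor <;> linarith [ha.2, hb.1]

theorem sub_le_dim (hφ : ContDiff ℝ ∞ φ) (hper : ZPer φ)
    (hpos : ∀ x, (hess (quadAdd φ) x).PosDef) (x y : Fin n → ℝ) : φ x - φ y ≤ n := by
  obtain ⟨x', hx', hxe⟩ := ZPer.exists_mem_Icc x
  obtain ⟨y', hy', hye⟩ := ZPer.exists_mem_Icc y
  rw [← hxe φ hper, ← hye φ hper]
  obtain ⟨c, -, hc⟩ := exists_hasDerivAt_eq_slope _ _ (zero_lt_one' ℝ)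
    (fun t _ => (hasDerivAt_line hφ y' (x' - y') t).continuousAt.continuousWithinAt)
    fun t _ => hasDerivAt_line hφ y' (x' - y') t
  simp only [one_smul, add_sub_cancel, zero_smul, add_zero, sub_zero, div_one] at hc
  rw [← hc]
  calc _ ≤ ∑ _i : Fin n, (1 : ℝ) := by
        refine Finset.sum_le_sum fun i _ => (le_abs_self _).trans ?_
        rw [abs_mul]
        refine mul_le_one₀ ?_ (abs_nonneg _) (abs_pd_le_one hφ hper hpos i _)
        have h1 := hx'.1 i
        have h2 := hx'.2 i
        have h3 := hy'.1 i
        have h4 := hy'.2 i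
        simp only [Pi.zero_apply, Pi.one_apply] at h1 h2 h3 h4
        rw [Pi.sub_apply, abs_le]
        constructor <;> linarith
    _ = n := by simp

theorem sum_sq_pd_le (hφ : ContDiff ℝ ∞ φ) (hper : ZPer φ)
    (hpos : ∀ x, (hess (quadAdd φ) x).PosDef) (x : Fin n → ℝ) : ∑ k, pd k φ x ^ 2 ≤ n := by
  calc _ ≤ ∑ _k : Fin n, (1 : ℝ) := Finset.sum_le_sum fun k _ =>
        (sq_le_one_iff_abs_le_one _).2 (abs_pd_le_one hφ hper hpos k x)
    _ = n := by simp

/-- In the coordinates `y = ∇u`, for `u = ½|x|² + φ`, this is minus the periodic part of the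
Legendre transform of `u`. -/
noncomputable def dualPotential (φ : (Fin n → ℝ) → ℝ) (x : Fin n → ℝ) : ℝ :=
  φ x + (1 / 2 : ℝ) * ∑ k, pd k φ x ^ 2

theorem contDiff_dualPotential (hφ : ContDiff ℝ ∞ φ) : ContDiff ℝ ∞ (dualPotential φ) :=
  hφ.add (contDiff_const.mul (ContDiff.sum fun k _ => (hφ.pd k).pow 2))

theorem ZPer.dualPotential (hper : ZPer φ) : ZPer (dualPotential φ) := by
  intro x m
  simp only [_root_.dualPotential, hper x m, (hper.pd _) x m]

theorem pd_dualPotential (hφ : ContDiff ℝ ∞ φ) (j : Fin n) (x : Fin n → ℝ) :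
    pd j (dualPotential φ) x = ∑ k, hess (quadAdd φ) x j k * pd k φ x := by
  have h2 : ∀ k : Fin n, ContDiff ℝ ∞ fun y => pd k φ y ^ 2 := fun k => (hφ.pd k).pow 2
  have h3 : ContDiff ℝ ∞ fun y => ∑ k, pd k φ y ^ 2 := ContDiff.sum fun k _ => h2 k
  unfold dualPotential
  rw [pd_add j (hφ.differentiableAt_of_smooth x)
    ((contDiff_const.mul h3).differentiableAt_of_smooth x),
    pd_const_mul j _ (h3.differentiableAt_of_smooth x),
    pd_sum j _ fun k _ => (h2 k).differentiableAt_of_smooth x]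
  simp only [pow_two, pd_mul j ((hφ.pd _).differentiableAt_of_smooth x)
    ((hφ.pd _).differentiableAt_of_smooth x), mul_comm (pd _ φ x), Finset.sum_add_distrib,
    hess_quadAdd hφ, Matrix.add_apply, add_mul, Matrix.one_apply, ite_mul, one_mul, zero_mul,
    Finset.sum_ite_eq, Finset.mem_univ, if_true]
  simp only [hess, Matrix.of_apply]
  ring

theorem hessDiv_dualPotential (hφ : ContDiff ℝ ∞ φ)
    (hpos : ∀ x, (hess (quadAdd φ) x).PosDef) (x : Fin n → ℝ) :
    hessDiv (quadAdd φ) (dualPotential φ) x = (hess (quadAdd φ) x).trace - n := by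
  have h : ∀ y i, ∑ j, (hess (quadAdd φ) y)⁻¹ i j * pd j (dualPotential φ) y = pd i φ y := by
    intro y i
    have h1 : (fun j => pd j (dualPotential φ) y) =
        hess (quadAdd φ) y *ᵥ fun k => pd k φ y := funext fun j => pd_dualPotential hφ j y
    change ((hess (quadAdd φ) y)⁻¹ *ᵥ fun j => pd j (dualPotential φ) y) i = _
    rw [h1, Matrix.mulVec_mulVec, Matrix.nonsing_inv_mul _ (hpos y).det_pos.ne'.isUnit,
      Matrix.one_mulVec]
  simp only [hessDiv, h]
  simp only [hess_quadAdd hφ, Matrix.trace_add, Matrix.trace_one, Fintype.card_fin,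
    add_sub_cancel_left]
  rfl

theorem hess_det_le (hφ : ContDiff ℝ ∞ φ) (hper : ZPer φ)
    (hpos : ∀ x, (hess (quadAdd φ) x).PosDef) {S : ℝ} (hS : ∀ x, |abreuOp (quadAdd φ) x| ≤ S)
    (x : Fin n → ℝ) :
    (hess (quadAdd φ) x).det ≤ (n + S) ^ n * Real.exp (2 * n) := by
  have hu := contDiff_quadAdd hφ
  have hL := contDiff_negLogDet hu hpos
  have hg := contDiff_dualPotential hφ
  have hF : ContDiff ℝ ∞ fun y => negLogDet (quadAdd φ) y - dualPotential φ y := hL.sub hg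
  have hFper : ZPer fun y => negLogDet (quadAdd φ) y - dualPotential φ y := fun y m => by
    simp only [zper_negLogDet_quadAdd hφ hper y m, hper.dualPotential y m]
  obtain ⟨x₀, hx₀⟩ := hFper.exists_forall_ge hF.continuous
  have h1 := hessDiv_nonneg_of_forall_ge hu hpos hF hx₀
  rw [hessDiv_sub hu hpos hL hg, ← abreuOp_eq_hessDiv hu hpos, hessDiv_dualPotential hφ hpos] at h1
  have htr : (hess (quadAdd φ) x₀).trace ≤ n + S := by
    linarith [(le_abs_self _).trans (hS x₀)]
  have hosc : dualPotential φ x₀ - dualPotential φ x ≤ 2 * n := by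
    have h2 := sub_le_dim hφ hper hpos x₀ x
    have h3 := sum_sq_pd_le hφ hper hpos x₀
    have h4 : 0 ≤ ∑ k, pd k φ x ^ 2 := Finset.sum_nonneg fun k _ => sq_nonneg _
    unfold dualPotential
    have : (0 : ℝ) ≤ n := n.cast_nonneg
    linarith
  have hlog : Real.log (hess (quadAdd φ) x).det ≤ Real.log (hess (quadAdd φ) x₀).det + 2 * n := by
    have h2 := hx₀ x
    simp only [negLogDet] at h2
    linarith
  rw [← Real.exp_le_exp, Real.exp_add, Real.exp_log (hpos x).det_pos,
    Real.exp_log (hpos x₀).det_pos] at hlog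
  refine hlog.trans (mul_le_mul_of_nonneg_right ?_ (Real.exp_pos _).le)
  exact (hpos x₀).posSemidef.det_le_trace_pow.trans
    (pow_le_pow_left₀ (hpos x₀).posSemidef.trace_nonneg htr n)

theorem inv_hess_det_le (hφ : ContDiff ℝ ∞ φ) (hper : ZPer φ)
    (hpos : ∀ x, (hess (quadAdd φ) x).PosDef) {S : ℝ} (hS : ∀ x, |abreuOp (quadAdd φ) x| ≤ S)
    (x : Fin n → ℝ) :
    (hess (quadAdd φ) x).det⁻¹ ≤ (2 * n + 4 * (n + 1) * S) ^ n * Real.exp n := by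
  have hu := contDiff_quadAdd hφ
  have hL := contDiff_negLogDet hu hpos
  have hn : (0 : ℝ) ≤ n := n.cast_nonneg
  obtain ⟨α, hα⟩ : ∃ α : ℝ, α = (2 * ((n : ℝ) + 1))⁻¹ := ⟨_, rfl⟩
  have hα0 : 0 < α := by rw [hα]; positivity
  have hα2 : α * (2 * (n + 1)) = 1 := by rw [hα]; field_simp
  have hcφ : ContDiff ℝ ∞ fun y => α * φ y := contDiff_const.mul hφ
  have hF : ContDiff ℝ ∞ fun y => α * φ y - negLogDet (quadAdd φ) y := hcφ.sub hL
  have hFper : ZPer fun y => α * φ y - negLogDet (quadAdd φ) y := fun y m => by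
    simp only [zper_negLogDet_quadAdd hφ hper y m, hper y m]
  obtain ⟨x₀, hx₀⟩ := hFper.exists_forall_ge hF.continuous
  have h1 := hessDiv_nonneg_of_forall_ge hu hpos hF hx₀
  rw [hessDiv_sub hu hpos hcφ hL, hessDiv_const_mul hu hpos hφ, ← abreuOp_eq_hessDiv hu hpos,
    hessDiv_eq hu hpos hφ] at h1
  have hcrit : ∀ k, pd k (negLogDet (quadAdd φ)) x₀ = α * pd k φ x₀ := by
    intro k
    have h2 := pd_eq_zero_of_forall_ge (f := fun y => α * φ y - negLogDet (quadAdd φ) y) hx₀ k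
    rw [pd_sub k (hcφ.differentiableAt_of_smooth x₀) (hL.differentiableAt_of_smooth x₀),
      pd_const_mul k α (hφ.differentiableAt_of_smooth x₀)] at h2
    linarith
  set G := (hess (quadAdd φ) x₀)⁻¹ with hG
  have hGpos : G.PosSemidef := (hpos x₀).inv.posSemidef
  have htrace : (G * hess φ x₀).trace = n - G.trace := by
    have h2 : hess φ x₀ = hess (quadAdd φ) x₀ - 1 := by rw [hess_quadAdd hφ]; abel
    rw [h2, Matrix.mul_sub, hG, Matrix.nonsing_inv_mul _ (hpos x₀).det_pos.ne'.isUnit,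
      Matrix.mul_one, Matrix.trace_sub, Matrix.trace_one, Fintype.card_fin]
  have hquad : ∑ k, (∑ a, G k a * pd a (negLogDet (quadAdd φ)) x₀) * pd k φ x₀ ≤
      α * (G.trace * n) := by
    have h2 := hGpos.dotProduct_mulVec_le fun k => pd k φ x₀
    have h3 : (fun k => pd k φ x₀) ⬝ᵥ (fun k => pd k φ x₀) ≤ n := by
      simpa only [dotProduct, pow_two] using sum_sq_pd_le hφ hper hpos x₀
    calc _ = α * ((fun k => pd k φ x₀) ⬝ᵥ G *ᵥ fun k => pd k φ x₀) := by
          simp only [hcrit, dotProduct, Matrix.mulVec, Finset.mul_sum, Finset.sum_mul]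
          refine Finset.sum_congr rfl fun k _ => Finset.sum_congr rfl fun a _ => ?_
          ring
      _ ≤ _ := mul_le_mul_of_nonneg_left
        (h2.trans (mul_le_mul_of_nonneg_left h3 hGpos.trace_nonneg)) hα0.le
  have htr : G.trace ≤ 2 * n + 4 * (n + 1) * S := by
    have hT := hGpos.trace_nonneg
    have hA := (neg_le_abs _).trans (hS x₀)
    rw [htrace] at h1
    have h4 := mul_le_mul_of_nonneg_left hquad hα0.le
    have h5 : α * (α * (G.trace * n)) ≤ α * (G.trace / 2) := by
      refine mul_le_mul_of_nonneg_left ?_ hα0.le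
      nlinarith
    have h6 : α * (G.trace / 2) ≤ α * n + S := by linarith
    have h7 := mul_le_mul_of_nonneg_left h6 (by positivity : (0 : ℝ) ≤ 2 * (2 * (n + 1)))
    calc G.trace = (α * (2 * (n + 1))) * G.trace := by rw [hα2, one_mul]
      _ = 2 * (2 * (n + 1)) * (α * (G.trace / 2)) := by ring
      _ ≤ 2 * (2 * (n + 1)) * (α * n + S) := h7
      _ = (α * (2 * (n + 1))) * (2 * n) + 4 * (n + 1) * S := by ring
      _ = _ := by rw [hα2, one_mul]
  have hle : negLogDet (quadAdd φ) x ≤ negLogDet (quadAdd φ) x₀ + n := by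
    have h2 := hx₀ x
    have h3 := mul_le_mul_of_nonneg_left (sub_le_dim hφ hper hpos x x₀) hα0.le
    nlinarith
  rw [← Real.exp_le_exp, Real.exp_add, exp_negLogDet hpos, exp_negLogDet hpos] at hle
  refine hle.trans (mul_le_mul_of_nonneg_right ?_ (Real.exp_pos _).le)
  rw [← Ring.inverse_eq_inv', ← Matrix.det_nonsing_inv]
  exact hGpos.det_le_trace_pow.trans (pow_le_pow_left₀ hGpos.trace_nonneg htr n)

end PeriodicPotential

theorem determinant_bounds (n : ℕ) (S : ℝ) :
    ∃ c₁ c₂ : ℝ, 0 < c₁ ∧ 0 < c₂ ∧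
      ∀ A φ : (Fin n → ℝ) → ℝ, ContDiff ℝ (⊤ : ℕ∞) A → ZPer A →
        (∀ x, |A x| ≤ S) →
        ContDiff ℝ (⊤ : ℕ∞) φ → ZPer φ →
        (∀ x, (hess (fun y => (1 / 2 : ℝ) * ∑ i, y i ^ 2 + φ y) x).PosDef) →
        (∀ x, abreuOp (fun y => (1 / 2 : ℝ) * ∑ i, y i ^ 2 + φ y) x = A x) →
        ∀ x, c₁ < (hess (fun y => (1 / 2 : ℝ) * ∑ i, y i ^ 2 + φ y) x).det ∧
          (hess (fun y => (1 / 2 : ℝ) * ∑ i, y i ^ 2 + φ y) x).det < c₂ := by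
  refine ⟨((2 * n + 4 * (n + 1) * |S|) ^ n * Real.exp n + 1)⁻¹,
    (n + |S|) ^ n * Real.exp (2 * n) + 1, by positivity, by positivity, ?_⟩
  intro A φ _ _ hS hφ hper hpos habreu x
  have hS' : ∀ y, |abreuOp (quadAdd φ) y| ≤ |S| := fun y => by
    rw [show abreuOp (quadAdd φ) y = A y from habreu y]
    exact (hS y).trans (le_abs_self S)
  constructor
  · rw [inv_lt_comm₀ (by positivity) (hpos x).det_pos]
    exact (inv_hess_det_le hφ hper hpos hS' x).trans_lt (lt_add_one _)
  · exact (hess_det_le hφ hper hpos hS' x).trans_lt (lt_add_one _)
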